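/- For every nonempty open subset ω of (0,π)², there exists a constant C_ω > 0 with the following property: for every positive integer N and every finitely supported family of complex coefficients (a_{jk}) indexed by pairs of positive integers (j,k) with j² + k² = N, the function φ(x,y) = Σ_{j²+k²=N} a_{jk} sin(jx) sin(ky) satisfies ∫_ω |φ(x,y)|² dx dy ≥ C_ω ∫_{[0,π]²} |φ(x,y)|² dx dy. Equivalently, every eigenfunction of the Dirichlet Laplacian on the square [0,π]² satisfies this observability inequality with a constant depending only on ω. -/

import Mathlib

open MeasureTheory Real

lemma circ_aux (px py ux uy vx vy D N : ℤ) (hp : px^2+py^2=N)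
    (hu : (px+ux)^2+(py+uy)^2=N) (hv : (px+vx)^2+(py+vy)^2=N)
    (h1 : |ux| ≤ D) (h2 : |uy| ≤ D) (h3 : |vx| ≤ D) (h4 : |vy| ≤ D)
    (hu0 : ¬ (ux = 0 ∧ uy = 0)) (hv0 : ¬ (vx = 0 ∧ vy = 0)) (hN : 8*D^6 < N) :
    ux = vx ∧ uy = vy := by
  have hD : 0 ≤ D := (abs_nonneg _).trans h1
  have eu : 2*(px*ux+py*uy) = -(ux^2+uy^2) := by linarith
  have ev : 2*(px*vx+py*vy) = -(vx^2+vy^2) := by linarith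
  have e1 : 2*px*(ux*vy-uy*vx) = -(ux^2+uy^2)*vy + (vx^2+vy^2)*uy := by
    linear_combination vy*eu - uy*ev
  have e2 : 2*py*(ux*vy-uy*vx) = (ux^2+uy^2)*vx - (vx^2+vy^2)*ux := by
    linear_combination -vx*eu + ux*ev
  have sq : ∀ t : ℤ, |t| ≤ D → t^2 ≤ D^2 := fun t ht => sq_le_sq' (by linarith [(abs_le.1 ht).1]) (abs_le.1 ht).2
  have hU : |ux^2+uy^2| ≤ 2*D^2 := by
    rw [abs_of_nonneg (by positivity)]; linarith [sq _ h1, sq _ h2]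
  have hV : |vx^2+vy^2| ≤ 2*D^2 := by
    rw [abs_of_nonneg (by positivity)]; linarith [sq _ h3, sq _ h4]
  have key : ∀ A B s t : ℤ, |A| ≤ 2*D^2 → |B| ≤ 2*D^2 → |s| ≤ D → |t| ≤ D →
      |A*s + B*t| ≤ 4*D^3 := by
    intro A B s t hA hB hs ht
    calc |A*s+B*t| ≤ |A*s|+|B*t| := abs_add_le _ _
      _ = |A| * |s| + |B| * |t| := by rw [abs_mul, abs_mul]
      _ ≤ 2*D^2*D+2*D^2*D := by gcongr
      _ = 4*D^3 := by ring
  by_cases hd : ux*vy-uy*vx = 0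
  · rw [hd] at e1 e2
    have hUp : 0 < ux^2+uy^2 := by
      rcases not_and_or.1 hu0 with h | h <;> positivity
    have hVp : 0 < vx^2+vy^2 := by
      rcases not_and_or.1 hv0 with h | h <;> positivity
    have f1 : (ux^2+uy^2)*vy = (vx^2+vy^2)*uy := by linarith
    have f2 : (ux^2+uy^2)*vx = (vx^2+vy^2)*ux := by linarith
    have f3 : (ux^2+uy^2)*(vx^2+vy^2)*(ux^2+uy^2) = (ux^2+uy^2)*(vx^2+vy^2)*(vx^2+vy^2) := by
      linear_combination ((ux^2+uy^2)*vy + (vx^2+vy^2)*uy) * f1 + ((ux^2+uy^2)*vx + (vx^2+vy^2)*ux) * f2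
    have f4 := mul_left_cancel₀ (by positivity) f3
    rw [← f4] at f1 f2
    exact ⟨(mul_left_cancel₀ hUp.ne' f2).symm, (mul_left_cancel₀ hUp.ne' f1).symm⟩
  · exfalso
    set d := ux*vy-uy*vx
    have hd1 : 1 ≤ d^2 := by
      have : 0 < d^2 := by positivity
      omega
    have b1 : |2*px*d| ≤ 4*D^3 := by
      rw [e1]; exact key _ _ _ _ (by rwa [abs_neg]) hV h4 h2
    have b2 : |2*py*d| ≤ 4*D^3 := by
      rw [e2, sub_eq_add_neg, ← neg_mul]; exact key _ _ _ _ hU (by rwa [abs_neg]) h3 h1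
    have c1 : (2*px*d)^2 ≤ (4*D^3)^2 := sq_le_sq' (by linarith [(abs_le.1 b1).1]) (abs_le.1 b1).2
    have c2 : (2*py*d)^2 ≤ (4*D^3)^2 := sq_le_sq' (by linarith [(abs_le.1 b2).1]) (abs_le.1 b2).2
    have c3 : 4*N*d^2 ≤ 32*D^6 := by rw [← hp]; linarith
    have hNp : 0 ≤ N := by rw [← hp]; positivity
    nlinarith

noncomputable def gg (u v x : ℝ) : ℝ := (x-u)*(v-x)

noncomputable def c1 (u v : ℝ) (k : ℤ) : ℂ := ∫ x in u..v, (gg u v x : ℂ) * Complex.exp (Complex.I * (k * x))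

lemma c1_zero {u v : ℝ} (huv : u < v) : c1 u v 0 = (‖c1 u v 0‖ : ℂ) := by
  have : c1 u v 0 = ((∫ x in u..v, gg u v x : ℝ) : ℂ) := by
    rw [← intervalIntegral.integral_ofReal]; simp [c1]
  rw [this, Complex.norm_real, Real.norm_of_nonneg]
  exact intervalIntegral.integral_nonneg huv.le fun x hx => mul_nonneg (by linarith [hx.1]) (by linarith [hx.2])

lemma c1_neg (u v : ℝ) (k : ℤ) : c1 u v (-k) = (starRingEnd ℂ) (c1 u v k) := by
  unfold c1
  rw [intervalIntegral.intervalIntegral_eq_integral_uIoc, intervalIntegral.intervalIntegral_eq_integral_uIoc]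
  rw [Complex.real_smul, Complex.real_smul, map_mul, Complex.conj_ofReal, ← integral_conj]
  congr 2
  ext x
  rw [map_mul, Complex.conj_ofReal, ← Complex.exp_conj]
  simp

lemma c1_decay (u v : ℝ) : ∃ K : ℝ, ∀ k : ℤ, ‖c1 u v k‖ ≤ K * |(k:ℝ)|^(-2:ℝ) ∨ k = 0 := by
  refine ⟨2*|u-v| + 4, fun k => ?_⟩
  by_cases hk : k = 0
  · exact Or.inr hk
  left
  have hk' : (k:ℂ) ≠ 0 := by exact_mod_cast hk
  have hI := Complex.I_ne_zero
  set w : ℂ := Complex.I * k with hw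
  have hw0 : w ≠ 0 := mul_ne_zero hI hk'
  have hd : ∀ x ∈ Set.uIcc u v, HasDerivAt (fun x : ℝ => Complex.exp (w * x) *
      (((x:ℂ)-u)*((v:ℂ)-x)/w - (u+v-2*x)/w^2 - 2/w^3)) ((gg u v x : ℂ) * Complex.exp (Complex.I * (k * x))) x := by
    intro x _
    have hx : HasDerivAt (fun x : ℝ => (x:ℂ)) 1 x := Complex.ofRealCLM.hasDerivAt
    have h1 := (hx.const_mul w).cexp
    have h2 := ((((hx.sub_const (u:ℂ)).mul ((hx.const_sub (v:ℂ)))).div_const w).sub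
      (((hx.const_mul 2).const_sub ((u:ℂ)+v)).div_const (w^2))).sub_const (2/w^3)
    have := h1.mul h2
    refine this.congr_deriv ?_
    simp only [gg]
    rw [← mul_assoc Complex.I, ← hw]
    push_cast
    simp only [Pi.sub_apply, Pi.mul_apply]
    field_simp
    ring
  have hc : c1 u v k = _ := intervalIntegral.integral_eq_sub_of_hasDerivAt hd (by unfold gg; apply Continuous.intervalIntegrable; fun_prop)
  rw [hc]
  have he : ∀ x : ℝ, ‖Complex.exp (w * x)‖ = 1 := by
    intro x
    rw [hw, show Complex.I * (k:ℂ) * x = ((k*x : ℝ) : ℂ) * Complex.I by push_cast; ring]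
    exact Complex.norm_exp_ofReal_mul_I _
  have hwn : ‖w‖ = |(k:ℝ)| := by simp [hw]
  have hk1 : 1 ≤ |(k:ℝ)| := by exact_mod_cast Int.one_le_abs hk
  have hb : ∀ x : ℝ, gg u v x = 0 → |u+v-2*x| = |u-v| → ‖Complex.exp (w * x) *
      (((x:ℂ)-u)*((v:ℂ)-x)/w - (u+v-2*x)/w^2 - 2/w^3)‖ ≤ (|u-v| + 2) * |(k:ℝ)|^(-2:ℝ) := by
    intro x h0 h1
    rw [norm_mul, he, one_mul, show ((x:ℂ)-u)*((v:ℂ)-x) = ((gg u v x : ℝ) : ℂ) by simp [gg], h0]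
    rw [Real.rpow_neg (by positivity), Real.rpow_ofNat]
    calc ‖((0:ℝ):ℂ)/w - (u+v-2*x)/w^2 - 2/w^3‖ = ‖((u+v-2*x : ℝ):ℂ)/w^2 + 2/w^3‖ := by
          rw [← norm_neg]; congr 1; push_cast; ring
      _ ≤ ‖((u+v-2*x : ℝ):ℂ)/w^2‖ + ‖2/w^3‖ := norm_add_le _ _
      _ = |u-v|/|(k:ℝ)|^2 + 2/|(k:ℝ)|^3 := by
          rw [norm_div, norm_div, norm_pow, norm_pow, hwn, Complex.norm_real, Real.norm_eq_abs, h1]; simp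
      _ ≤ |u-v|/|(k:ℝ)|^2 + 2/|(k:ℝ)|^2 := by gcongr <;> norm_num
      _ = _ := by ring
  calc _ ≤ _ := norm_sub_le _ _
    _ ≤ (|u-v| + 2) * |(k:ℝ)|^(-2:ℝ) + (|u-v| + 2) * |(k:ℝ)|^(-2:ℝ) := by
      refine add_le_add (hb v (by simp [gg]) ?_) (hb u (by simp [gg]) ?_)
      · congr 1; ring
      · rw [abs_sub_comm u v]; congr 1; ring
    _ = _ := by ring

lemma c1_summable (u v : ℝ) : Summable fun k => ‖c1 u v k‖ := by
  obtain ⟨K, hK⟩ := c1_decay u v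
  have h : Summable fun k : ℤ => K * |(k:ℝ)|^(-2:ℝ) := (Real.summable_abs_int_rpow (by norm_num)).mul_left K
  have h2 : Summable fun k : ℤ => if k = 0 then ‖c1 u v 0‖ else 0 :=
    summable_of_ne_finset_zero (s := {0}) (by intro b hb; simp at hb; simp [hb])
  refine Summable.of_nonneg_of_le (fun _ => norm_nonneg _) (fun k => ?_) (h.add h2)
  rcases hK k with h | h
  · have : 0 ≤ if k = 0 then ‖c1 u v 0‖ else 0 := by split_ifs <;> positivity
    linarith
  · subst h; simp

lemma c1_lt {u v : ℝ} (huv : u < v) {k : ℤ} (hk : k ≠ 0) : ‖c1 u v k‖ < ‖c1 u v 0‖ := by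
  obtain ⟨θ, hθ⟩ : ∃ θ : ℝ, (‖c1 u v k‖ : ℂ) = Complex.exp (-(θ * Complex.I)) * c1 u v k := by
    refine ⟨(c1 u v k).arg, ?_⟩
    nth_rw 3 [← Complex.norm_mul_exp_arg_mul_I (c1 u v k)]
    rw [mul_left_comm, ← Complex.exp_add]; simp
  have h1 : ‖c1 u v k‖ = ∫ x in u..v, gg u v x * Real.cos (k*x-θ) := by
    have : ((‖c1 u v k‖ : ℂ)).re = ∫ x in u..v, gg u v x * Real.cos (k*x-θ) := by
      rw [hθ, c1, ← intervalIntegral.integral_const_mul]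
      have := Complex.reCLM.intervalIntegral_comp_comm (a := u) (b := v) (μ := volume) (f := fun x : ℝ => Complex.exp (-(θ * Complex.I)) * ((gg u v x : ℂ) * Complex.exp (Complex.I * (k * x)))) (by unfold gg; apply Continuous.intervalIntegrable; fun_prop)
      rw [Complex.reCLM_apply] at this
      rw [← this]
      congr 1; ext x
      rw [Complex.reCLM_apply, mul_left_comm, ← Complex.exp_add, Complex.re_ofReal_mul]
      rw [show -(θ * Complex.I) + Complex.I * (k * x) = ((k*x-θ:ℝ):ℂ) * Complex.I by push_cast; ring]
      rw [Complex.exp_ofReal_mul_I_re]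
    simpa using this
  have h0 : ‖c1 u v 0‖ = ∫ x in u..v, gg u v x := by
    have : c1 u v 0 = ((∫ x in u..v, gg u v x : ℝ) : ℂ) := by
      rw [← intervalIntegral.integral_ofReal]; simp [c1]
    rw [this, Complex.norm_real, Real.norm_of_nonneg]
    exact intervalIntegral.integral_nonneg huv.le fun x hx => mul_nonneg (by linarith [hx.1]) (by linarith [hx.2])
  rw [h1, h0]
  refine intervalIntegral.integral_lt_integral_of_continuousOn_of_le_of_exists_lt huv (by unfold gg; fun_prop) (by unfold gg; fun_prop) ?_ ?_
  · intro x hx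
    have : 0 ≤ gg u v x := mul_nonneg (by linarith [hx.1]) (by linarith [hx.2])
    nlinarith [Real.cos_le_one (k*x-θ)]
  · by_contra! hcon
    have hone : ∀ x ∈ Set.Ioo u v, Real.cos (k*x-θ) = 1 := by
      intro x hx
      have hp : 0 < gg u v x := mul_pos (by linarith [hx.1]) (by linarith [hx.2])
      have := hcon x ⟨hx.1.le, hx.2.le⟩
      have := Real.cos_le_one (k*x-θ)
      nlinarith
    have hk' : (k:ℝ) ≠ 0 := by exact_mod_cast hk
    set m := (u+v)/2 with hm
    have hmm : m ∈ Set.Ioo u v := ⟨by linarith, by linarith⟩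
    -- second derivative at the midpoint
    have hev : (fun x : ℝ => Real.cos (k*x-θ)) =ᶠ[nhds m] fun _ => 1 := by
      filter_upwards [isOpen_Ioo.mem_nhds hmm] with x hx using hone x hx
    have hev1 := hev.deriv
    have hd1 : deriv (fun x : ℝ => Real.cos (k*x-θ)) = fun x => -Real.sin (k*x-θ) * k := by
      ext x
      have := (((hasDerivAt_id x).const_mul (k:ℝ)).sub_const θ).cos
      simpa using this.deriv
    have hev2 := hev1.deriv.eq_of_nhds
    have hd2 : deriv (fun x : ℝ => -Real.sin (k*x-θ) * k) m = -(Real.cos (k*m-θ)*k)*k := by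
      have := ((((hasDerivAt_id m).const_mul (k:ℝ)).sub_const θ).sin.neg.mul_const (k:ℝ))
      simpa using this.deriv
    rw [hd1, hd2, hone m hmm] at hev2
    simp [hk'] at hev2

lemma c1_gap {u v : ℝ} (huv : u < v) : ∃ ρ : ℝ, 0 ≤ ρ ∧ ρ < 1 ∧ ∀ k : ℤ, k ≠ 0 → ‖c1 u v k‖ ≤ ρ * ‖c1 u v 0‖ := by
  have hpos : 0 < ‖c1 u v 0‖ := (norm_nonneg _).trans_lt (c1_lt huv (k := 1) one_ne_zero)
  have ht := (c1_summable u v).tendsto_cofinite_zero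
  have hf : {k : ℤ | ¬ ‖c1 u v k‖ < ‖c1 u v 0‖ / 2}.Finite := by
    have := ht.eventually_lt_const (half_pos hpos)
    exact Filter.eventually_cofinite.1 this
  set T := hf.toFinset.erase 0
  obtain ⟨r, hr0, hr1, hr⟩ : ∃ r : ℝ, 0 ≤ r ∧ r < 1 ∧ ∀ k ∈ T, ‖c1 u v k‖ ≤ r * ‖c1 u v 0‖ := by
    have : ∀ s : Finset ℤ, 0 ∉ s → ∃ r : ℝ, 0 ≤ r ∧ r < 1 ∧ ∀ k ∈ s, ‖c1 u v k‖ ≤ r * ‖c1 u v 0‖ := by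
      intro s
      induction s using Finset.induction_on with
      | empty => exact fun _ => ⟨0, le_rfl, one_pos, by simp⟩
      | insert a s ha ih =>
        intro h0
        simp only [Finset.mem_insert, not_or] at h0
        obtain ⟨r, h1, h2, h3⟩ := ih h0.2
        refine ⟨max r (‖c1 u v a‖ / ‖c1 u v 0‖), le_max_of_le_left h1, max_lt h2 ?_, ?_⟩
        · rw [div_lt_one hpos]; exact c1_lt huv (Ne.symm h0.1)
        · intro k hk
          rcases Finset.mem_insert.1 hk with rfl | hk
          · rw [← div_le_iff₀ hpos]; exact le_max_right _ _
          · exact (h3 k hk).trans (by gcongr; exact le_max_left _ _)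
    exact this T (by simp [T])
  refine ⟨max r (1/2), le_max_of_le_left hr0, max_lt hr1 (by norm_num), fun k hk => ?_⟩
  by_cases hkT : k ∈ T
  · exact (hr k hkT).trans (by gcongr; exact le_max_left _ _)
  · have : ‖c1 u v k‖ < ‖c1 u v 0‖ / 2 := by
      by_contra h
      exact hkT (by simp [T, hk]; simpa using h)
    calc _ ≤ 1/2 * ‖c1 u v 0‖ := by linarith
      _ ≤ _ := by gcongr; exact le_max_right _ _

noncomputable def cc (u v s t : ℝ) (n : ℤ × ℤ) : ℂ := c1 u v n.1 * c1 s t n.2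

noncomputable def ee (n : ℤ × ℤ) (x : ℝ × ℝ) : ℂ :=
  Complex.exp (Complex.I * (n.1 * x.1)) * Complex.exp (Complex.I * (n.2 * x.2))

noncomputable def FF (S : Finset (ℤ × ℤ)) (a : ℤ × ℤ → ℂ) (x : ℝ × ℝ) : ℂ := ∑ n ∈ S, a n * ee n x

@[fun_prop]
lemma ee_cont (n : ℤ × ℤ) : Continuous (ee n) := by unfold ee; fun_prop

@[fun_prop]
lemma FF_cont (S : Finset (ℤ × ℤ)) (a : ℤ × ℤ → ℂ) : Continuous (FF S a) := by unfold FF; fun_prop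

@[fun_prop]
lemma gg_cont (u v : ℝ) : Continuous (gg u v) := by unfold gg; fun_prop

lemma ee_mul_conj (n m : ℤ × ℤ) (x : ℝ × ℝ) : ee n x * (starRingEnd ℂ) (ee m x) = ee (n-m) x := by
  unfold ee
  rw [map_mul, ← Complex.exp_conj, ← Complex.exp_conj, ← Complex.exp_add, ← Complex.exp_add,
    ← Complex.exp_add, ← Complex.exp_add]
  congr 1
  simp
  ring

lemma cc_int {u v s t : ℝ} (huv : u ≤ v) (hst : s ≤ t) (n : ℤ × ℤ) :
    ∫ x in Set.Icc u v ×ˢ Set.Icc s t, ((gg u v x.1 * gg s t x.2 : ℝ) : ℂ) * ee n x = cc u v s t n := by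
  have h := setIntegral_prod_mul (μ := (volume : Measure ℝ)) (ν := (volume : Measure ℝ))
    (fun x : ℝ => (gg u v x : ℂ) * Complex.exp (Complex.I * (n.1 * x)))
    (fun x : ℝ => (gg s t x : ℂ) * Complex.exp (Complex.I * (n.2 * x))) (Set.Icc u v) (Set.Icc s t)
  unfold cc c1
  rw [intervalIntegral.integral_of_le huv, intervalIntegral.integral_of_le hst,
    ← integral_Icc_eq_integral_Ioc, ← integral_Icc_eq_integral_Ioc, ← h, Measure.volume_eq_prod]
  congr 1
  ext x
  simp only [ee]
  push_cast
  ring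

lemma expand {u v s t : ℝ} (huv : u ≤ v) (hst : s ≤ t) (S : Finset (ℤ × ℤ)) (a : ℤ × ℤ → ℂ) :
    ((∫ x in Set.Icc u v ×ˢ Set.Icc s t, gg u v x.1 * gg s t x.2 * ‖FF S a x‖^2 : ℝ) : ℂ) =
      ∑ n ∈ S, ∑ m ∈ S, a n * (starRingEnd ℂ) (a m) * cc u v s t (n - m) := by
  rw [← integral_complex_ofReal]
  have : ∀ x : ℝ × ℝ, ((gg u v x.1 * gg s t x.2 * ‖FF S a x‖^2 : ℝ) : ℂ) =
      ∑ n ∈ S, ∑ m ∈ S, a n * (starRingEnd ℂ) (a m) * (((gg u v x.1 * gg s t x.2 : ℝ) : ℂ) * ee (n-m) x) := by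
    intro x
    rw [Complex.ofReal_mul, Complex.ofReal_pow, ← Complex.mul_conj', FF, map_sum, Finset.sum_mul_sum, Finset.mul_sum]
    refine Finset.sum_congr rfl fun n _ => ?_
    rw [Finset.mul_sum]
    refine Finset.sum_congr rfl fun m _ => ?_
    rw [map_mul, ← ee_mul_conj]
    ring
  simp_rw [this]
  have hi : ∀ n m : ℤ × ℤ, IntegrableOn (fun x : ℝ × ℝ => a n * (starRingEnd ℂ) (a m) * (((gg u v x.1 * gg s t x.2 : ℝ) : ℂ) * ee (n-m) x)) (Set.Icc u v ×ˢ Set.Icc s t) := by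
    intro n m
    apply Continuous.continuousOn (by fun_prop) |>.integrableOn_compact
    exact isCompact_Icc.prod isCompact_Icc
  rw [integral_finsetSum _ (fun n _ => integrable_finsetSum _ fun m _ => hi n m)]
  refine Finset.sum_congr rfl fun n _ => ?_
  rw [integral_finsetSum _ (fun m _ => hi n m)]
  refine Finset.sum_congr rfl fun m _ => ?_
  rw [integral_const_mul, cc_int huv hst]

lemma cc_neg (u v s t : ℝ) (n : ℤ × ℤ) : ‖cc u v s t (-n)‖ = ‖cc u v s t n‖ := by
  simp [cc, c1_neg]

lemma cc_zero {u v s t : ℝ} (huv : u < v) (hst : s < t) : cc u v s t 0 = (‖cc u v s t 0‖ : ℂ) := by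
  simp only [cc, Prod.fst_zero, Prod.snd_zero, norm_mul]
  push_cast
  rw [← c1_zero huv, ← c1_zero hst]

lemma cc_pos {u v s t : ℝ} (huv : u < v) (hst : s < t) : 0 < ‖cc u v s t 0‖ := by
  simp only [cc, Prod.fst_zero, Prod.snd_zero, norm_mul]
  exact mul_pos ((norm_nonneg _).trans_lt (c1_lt huv (k := 1) one_ne_zero))
    ((norm_nonneg _).trans_lt (c1_lt hst (k := 1) one_ne_zero))

lemma cc_summable (u v s t : ℝ) : Summable fun n => ‖cc u v s t n‖ := by
  simp only [cc, norm_mul]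
  exact (c1_summable u v).mul_of_nonneg (c1_summable s t) (fun _ => norm_nonneg _) (fun _ => norm_nonneg _)

lemma c1_le {u v : ℝ} (huv : u < v) (k : ℤ) : ‖c1 u v k‖ ≤ ‖c1 u v 0‖ := by
  by_cases h : k = 0
  · rw [h]
  · exact (c1_lt huv h).le

lemma cc_gap {u v s t : ℝ} (huv : u < v) (hst : s < t) : ∃ ρ : ℝ, 0 ≤ ρ ∧ ρ < 1 ∧
    ∀ n : ℤ × ℤ, n ≠ 0 → ‖cc u v s t n‖ ≤ ρ * ‖cc u v s t 0‖ := by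
  obtain ⟨r, r0, r1, hr⟩ := c1_gap huv
  obtain ⟨q, q0, q1, hq⟩ := c1_gap hst
  refine ⟨max r q, le_max_of_le_left r0, max_lt r1 q1, fun n hn => ?_⟩
  simp only [cc, Prod.fst_zero, Prod.snd_zero, norm_mul]
  by_cases h : n.1 = 0
  · have h2 : n.2 ≠ 0 := fun h2 => hn (Prod.ext h h2)
    calc _ ≤ ‖c1 u v 0‖ * (q * ‖c1 s t 0‖) := by
          gcongr
          · exact c1_le huv _
          · exact hq _ h2
      _ = q * (‖c1 u v 0‖ * ‖c1 s t 0‖) := by ring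
      _ ≤ _ := by gcongr; exact le_max_right _ _
  · calc _ ≤ (r * ‖c1 u v 0‖) * ‖c1 s t 0‖ := by
          gcongr
          · exact hr _ h
          · exact c1_le hst _
      _ = r * (‖c1 u v 0‖ * ‖c1 s t 0‖) := by ring
      _ ≤ _ := by gcongr; exact le_max_left _ _

/-- Schur test -/
lemma schur (S : Finset (ℤ × ℤ)) (a : ℤ × ℤ → ℂ) (w : ℤ × ℤ → ℝ) (hw : ∀ n, 0 ≤ w n)
    (hneg : ∀ n, w (-n) = w n) (B : ℝ) (hB : ∀ n ∈ S, ∑ m ∈ S, w (n - m) ≤ B) :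
    ∑ n ∈ S, ∑ m ∈ S, ‖a n‖ * ‖a m‖ * w (n - m) ≤ B * ∑ n ∈ S, ‖a n‖^2 := by
  have h1 : ∑ n ∈ S, ∑ m ∈ S, ‖a n‖^2 * w (n - m) ≤ B * ∑ n ∈ S, ‖a n‖^2 := by
    rw [Finset.mul_sum]
    refine Finset.sum_le_sum fun n hn => ?_
    rw [← Finset.mul_sum, mul_comm]
    gcongr
    exact hB n hn
  have h2 : ∑ n ∈ S, ∑ m ∈ S, ‖a m‖^2 * w (n - m) = ∑ n ∈ S, ∑ m ∈ S, ‖a n‖^2 * w (n - m) := by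
    rw [Finset.sum_comm]
    refine Finset.sum_congr rfl fun n _ => Finset.sum_congr rfl fun m _ => ?_
    rw [← hneg, neg_sub]
  have h3 : ∑ n ∈ S, ∑ m ∈ S, ‖a n‖ * ‖a m‖ * w (n - m) ≤
      ∑ n ∈ S, ∑ m ∈ S, (‖a n‖^2 * w (n - m) + ‖a m‖^2 * w (n - m))/2 := by
    refine Finset.sum_le_sum fun n _ => Finset.sum_le_sum fun m _ => ?_
    nlinarith [hw (n-m), mul_nonneg (hw (n-m)) (sq_nonneg (‖a n‖ - ‖a m‖))]
  simp_rw [← Finset.sum_div, Finset.sum_add_distrib] at h3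
  linarith

lemma upper {u v s t : ℝ} (huv : u ≤ v) (hst : s ≤ t) (S : Finset (ℤ × ℤ)) (a : ℤ × ℤ → ℂ) :
    (∫ x in Set.Icc u v ×ˢ Set.Icc s t, gg u v x.1 * gg s t x.2 * ‖FF S a x‖^2 : ℝ) ≤
      (∑' n, ‖cc u v s t n‖) * ∑ n ∈ S, ‖a n‖^2 := by
  have h := expand huv hst S a
  have h' := congrArg norm h
  rw [Complex.norm_real] at h'
  refine (le_abs_self _).trans ?_
  rw [← Real.norm_eq_abs, h']
  calc _ ≤ ∑ n ∈ S, ∑ m ∈ S, ‖a n‖ * ‖a m‖ * ‖cc u v s t (n - m)‖ := by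
        refine (norm_sum_le _ _).trans (Finset.sum_le_sum fun n _ => (norm_sum_le _ _).trans (Finset.sum_le_sum fun m _ => ?_))
        simp
    _ ≤ _ := by
        refine schur S a (fun n => ‖cc u v s t n‖) (fun _ => norm_nonneg _) (cc_neg u v s t) _ fun n _ => ?_
        rw [← Finset.sum_image (f := fun k => ‖cc u v s t k‖) (g := fun m => n - m) (by intro x _ y _ h; simpa using h)]
        exact (cc_summable u v s t).sum_le_tsum _ (fun _ _ => norm_nonneg _)

lemma lower {u v s t : ℝ} (huv : u < v) (hst : s < t) (S : Finset (ℤ × ℤ)) (a : ℤ × ℤ → ℂ) (B : ℝ)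
    (hB : ∀ n ∈ S, ∑ m ∈ S.erase n, ‖cc u v s t (n - m)‖ ≤ B) :
    (‖cc u v s t 0‖ - B) * ∑ n ∈ S, ‖a n‖^2 ≤
    (∫ x in Set.Icc u v ×ˢ Set.Icc s t, gg u v x.1 * gg s t x.2 * ‖FF S a x‖^2 : ℝ) := by
  set Q := (∫ x in Set.Icc u v ×ˢ Set.Icc s t, gg u v x.1 * gg s t x.2 * ‖FF S a x‖^2 : ℝ)
  have h := expand huv.le hst.le S a
  set d : ℤ × ℤ → ℂ := fun n => if n = 0 then 0 else cc u v s t n with hd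
  have hsplit : ∀ n, cc u v s t n = (if n = 0 then (‖cc u v s t 0‖ : ℂ) else 0) + d n := by
    intro n
    by_cases hn : n = 0
    · simp [hd, hn]; exact cc_zero huv hst
    · simp [hd, hn]
  have e1 : (Q : ℂ) = ((‖cc u v s t 0‖ * ∑ n ∈ S, ‖a n‖^2 : ℝ) : ℂ) +
      ∑ n ∈ S, ∑ m ∈ S, a n * (starRingEnd ℂ) (a m) * d (n - m) := by
    rw [h]
    push_cast
    rw [Finset.mul_sum, ← Finset.sum_add_distrib]
    refine Finset.sum_congr rfl fun n hn => ?_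
    simp_rw [hsplit (n - _), mul_add, Finset.sum_add_distrib, sub_eq_zero]
    congr 1
    simp [hn, Complex.mul_conj', mul_comm]
  have e2 : ‖∑ n ∈ S, ∑ m ∈ S, a n * (starRingEnd ℂ) (a m) * d (n - m)‖ ≤ B * ∑ n ∈ S, ‖a n‖^2 := by
    calc _ ≤ ∑ n ∈ S, ∑ m ∈ S, ‖a n‖ * ‖a m‖ * ‖d (n - m)‖ := by
          refine (norm_sum_le _ _).trans (Finset.sum_le_sum fun n _ => (norm_sum_le _ _).trans (Finset.sum_le_sum fun m _ => ?_))
          simp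
      _ ≤ _ := by
          refine schur S a (fun n => ‖d n‖) (fun _ => norm_nonneg _) ?_ _ fun n hn => ?_
          · intro n
            by_cases hn : n = 0
            · simp [hd, hn]
            · simp [hd, hn, cc_neg]
          · refine le_trans (le_of_eq ?_) (hB n hn)
            rw [← Finset.sum_erase S (a := n) (by simp [hd])]
            refine Finset.sum_congr rfl fun m hm => ?_
            have : n - m ≠ 0 := sub_ne_zero.2 (Finset.ne_of_mem_erase hm).symm
            simp [hd, this]
  have e3 : (∑ n ∈ S, ∑ m ∈ S, a n * (starRingEnd ℂ) (a m) * d (n - m)) =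
      ((Q - ‖cc u v s t 0‖ * ∑ n ∈ S, ‖a n‖^2 : ℝ) : ℂ) := by
    rw [Complex.ofReal_sub, e1]; ring
  rw [e3, Complex.norm_real, Real.norm_eq_abs] at e2
  linarith [(abs_le.1 e2).1]

lemma lower_large {u v s t : ℝ} (huv : u < v) (hst : s < t) : ∃ C : ℝ, 0 < C ∧ ∃ N₀ : ℕ, ∀ N : ℕ, N₀ < N →
    ∀ S : Finset (ℤ × ℤ), (∀ n ∈ S, n.1^2+n.2^2 = (N:ℤ)) → ∀ a : ℤ × ℤ → ℂ,
    C * ∑ n ∈ S, ‖a n‖^2 ≤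
    (∫ x in Set.Icc u v ×ˢ Set.Icc s t, gg u v x.1 * gg s t x.2 * ‖FF S a x‖^2 : ℝ) := by
  obtain ⟨ρ, r0, r1, hρ⟩ := cc_gap huv hst
  have hp := cc_pos huv hst
  set c0 := ‖cc u v s t 0‖ with hc0
  have hε : 0 < (1-ρ)*c0/2 := by have : 0 < 1 - ρ := by linarith
                                 positivity
  obtain ⟨T, hT⟩ := summable_iff_vanishing_norm.1 (cc_summable u v s t) _ hε
  obtain ⟨D, hD⟩ : ∃ D : ℕ, ∀ k ∈ T, |k.1| ≤ (D:ℤ) ∧ |k.2| ≤ (D:ℤ) := by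
    refine ⟨T.sup fun k => max k.1.natAbs k.2.natAbs, fun k hk => ?_⟩
    have := Finset.le_sup (f := fun k : ℤ × ℤ => max k.1.natAbs k.2.natAbs) hk
    rw [Int.abs_eq_natAbs, Int.abs_eq_natAbs]
    constructor <;> norm_cast <;> omega
  refine ⟨(1-ρ)*c0/2, hε, 8*D^6, fun N hN S hS a => ?_⟩
  have hN' : 8*(D:ℤ)^6 < N := by exact_mod_cast hN
  refine le_trans (le_of_eq ?_) (lower huv hst S a (ρ*c0 + (1-ρ)*c0/2) fun n hn => ?_)
  · congr 1; ring
  rw [← Finset.sum_filter_add_sum_filter_not (S.erase n) (fun m => n - m ∈ T)]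
  gcongr
  · have hcard : ((S.erase n).filter (fun m => n - m ∈ T)).card ≤ 1 := by
      rw [Finset.card_le_one]
      intro m hm m' hm'
      simp only [Finset.mem_filter, Finset.mem_erase] at hm hm'
      have d1 := hD _ hm.2
      have d2 := hD _ hm'.2
      have := circ_aux n.1 n.2 (m.1-n.1) (m.2-n.2) (m'.1-n.1) (m'.2-n.2) D N (hS n hn)
        (by simpa using hS m hm.1.2) (by simpa using hS m' hm'.1.2)
        (by rw [abs_sub_comm]; exact d1.1) (by rw [abs_sub_comm]; exact d1.2)
        (by rw [abs_sub_comm]; exact d2.1) (by rw [abs_sub_comm]; exact d2.2)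
        (fun h => hm.1.1 (Prod.ext (by linarith [h.1]) (by linarith [h.2])))
        (fun h => hm'.1.1 (Prod.ext (by linarith [h.1]) (by linarith [h.2]))) hN'
      exact Prod.ext (by linarith [this.1]) (by linarith [this.2])
    calc _ ≤ ((S.erase n).filter (fun m => n - m ∈ T)).card • (ρ*c0) := by
          refine Finset.sum_le_card_nsmul _ _ _ fun m hm => hρ _ ?_
          simp only [Finset.mem_filter, Finset.mem_erase] at hm
          exact sub_ne_zero.2 hm.1.1.symm
      _ ≤ 1 • (ρ*c0) := by gcongr
      _ = _ := one_smul _ _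
  · rw [← Finset.sum_image (f := fun k => ‖cc u v s t k‖) (g := fun m => n - m) (by intro x _ y _ h; simpa using h)]
    refine le_trans (le_abs_self _) (hT _ ?_).le
    rw [Finset.disjoint_left]
    intro k hk
    simp only [Finset.mem_image, Finset.mem_filter] at hk
    obtain ⟨m, hm, rfl⟩ := hk
    exact hm.2

noncomputable def eeHom (n : ℤ × ℤ) : Multiplicative (ℝ × ℝ) →* ℂ where
  toFun x := ee n x.toAdd
  map_one' := by simp [ee]
  map_mul' x y := by
    simp only [ee, toAdd_mul, Prod.fst_add, Prod.snd_add, Complex.ofReal_add, mul_add, Complex.exp_add]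
    ring

lemma exp_ne {j k : ℤ} (h : j ≠ k) : Complex.exp (Complex.I * (j * (π / (j - k) : ℝ))) ≠
    Complex.exp (Complex.I * (k * (π / (j - k) : ℝ))) := by
  intro he
  have hjk : (j:ℂ) - k ≠ 0 := sub_ne_zero.2 (by exact_mod_cast h)
  have : Complex.exp (Complex.I * (j * (π / (j - k) : ℝ))) =
      Complex.exp (π * Complex.I) * Complex.exp (Complex.I * (k * (π / (j - k) : ℝ))) := by
    rw [← Complex.exp_add]
    congr 1
    push_cast
    field_simp
    ring
  rw [this, Complex.exp_pi_mul_I, neg_one_mul] at he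
  have h0 := Complex.exp_ne_zero (Complex.I * (k * (π / (j - k) : ℝ)))
  exact h0 (by linear_combination (-1/2) * he)

lemma eeHom_inj : Function.Injective eeHom := by
  intro n m h
  have h' : ∀ x, ee n x = ee m x := fun x => DFunLike.congr_fun h (Multiplicative.ofAdd x)
  ext
  · by_contra hne
    have := h' ((π / (n.1 - m.1) : ℝ), 0)
    simp only [ee, Complex.ofReal_zero, mul_zero, Complex.exp_zero, mul_one] at this
    exact exp_ne hne this
  · by_contra hne
    have := h' (0, (π / (n.2 - m.2) : ℝ))
    simp only [ee, Complex.ofReal_zero, mul_zero, Complex.exp_zero, one_mul] at this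
    exact exp_ne hne this

lemma FF_analytic (S : Finset (ℤ × ℤ)) (a : ℤ × ℤ → ℂ) : AnalyticOnNhd ℝ (FF S a) Set.univ := by
  intro x _
  unfold FF
  apply Finset.analyticAt_fun_sum
  intro n _
  apply AnalyticAt.mul analyticAt_const
  unfold ee
  have hx1 : AnalyticAt ℝ (fun x : ℝ × ℝ => (x.1 : ℂ)) x :=
    (Complex.ofRealCLM.comp (ContinuousLinearMap.fst ℝ ℝ ℝ)).analyticAt x
  have hx2 : AnalyticAt ℝ (fun x : ℝ × ℝ => (x.2 : ℂ)) x :=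
    (Complex.ofRealCLM.comp (ContinuousLinearMap.snd ℝ ℝ ℝ)).analyticAt x
  have hexp : ∀ z : ℂ, AnalyticAt ℝ Complex.exp z := fun z => (analyticAt_cexp (z := z)).restrictScalars
  exact ((hexp _).fun_comp (analyticAt_const.mul (analyticAt_const.mul hx1))).mul
    ((hexp _).fun_comp (analyticAt_const.mul (analyticAt_const.mul hx2)))

lemma FF_indep {u v s t : ℝ} (huv : u < v) (hst : s < t) (S : Finset (ℤ × ℤ)) (a : ℤ × ℤ → ℂ)
    (h : ∀ x ∈ Set.Ioo u v ×ˢ Set.Ioo s t, FF S a x = 0) : ∀ n ∈ S, a n = 0 := by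
  have hall : FF S a = 0 := by
    have hm : ((u+v)/2, (s+t)/2) ∈ Set.Ioo u v ×ˢ Set.Ioo s t :=
      ⟨⟨by simp; linarith, by simp; linarith⟩, ⟨by simp; linarith, by simp; linarith⟩⟩
    have := (FF_analytic S a).eqOn_zero_of_preconnected_of_eventuallyEq_zero isPreconnected_univ
      (Set.mem_univ ((u+v)/2, (s+t)/2)) (by
        filter_upwards [(isOpen_Ioo.prod isOpen_Ioo).mem_nhds hm] with x hx using h x hx)
    ext x
    exact this (Set.mem_univ x)
  have hli := (linearIndependent_monoidHom (Multiplicative (ℝ × ℝ)) ℂ).comp eeHom eeHom_inj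
  rw [linearIndependent_iff'] at hli
  refine hli S a ?_
  ext x
  have := congrFun hall x.toAdd
  simpa [FF, eeHom] using this

lemma weight_pos {u v s t : ℝ} (huv : u < v) (hst : s < t) (S : Finset (ℤ × ℤ)) (a : ℤ × ℤ → ℂ)
    (ha : ∃ n ∈ S, a n ≠ 0) :
    0 < (∫ x in Set.Icc u v ×ˢ Set.Icc s t, gg u v x.1 * gg s t x.2 * ‖FF S a x‖^2 : ℝ) := by
  have hg : ∀ x ∈ Set.Icc u v ×ˢ Set.Icc s t, 0 ≤ gg u v x.1 * gg s t x.2 * ‖FF S a x‖^2 := by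
    rintro x ⟨hx, hy⟩
    have h1 : 0 ≤ gg u v x.1 := mul_nonneg (by linarith [hx.1]) (by linarith [hx.2])
    have h2 : 0 ≤ gg s t x.2 := mul_nonneg (by linarith [hy.1]) (by linarith [hy.2])
    positivity
  obtain ⟨x₀, hx₀, hne⟩ : ∃ x ∈ Set.Ioo u v ×ˢ Set.Ioo s t, FF S a x ≠ 0 := by
    by_contra! hcon
    obtain ⟨n, hn, hn'⟩ := ha
    exact hn' (FF_indep huv hst S a hcon n hn)
  have hmeas : MeasurableSet (Set.Icc u v ×ˢ Set.Icc s t) := measurableSet_Icc.prod measurableSet_Icc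
  have hcont : Continuous (fun x : ℝ × ℝ => gg u v x.1 * gg s t x.2 * ‖FF S a x‖^2) := by fun_prop
  rw [setIntegral_pos_iff_support_of_nonneg_ae (by filter_upwards [ae_restrict_mem hmeas] with x hx using hg x hx)
    (hcont.continuousOn.integrableOn_compact (isCompact_Icc.prod isCompact_Icc))]
  have hopen : IsOpen (Function.support (fun x : ℝ × ℝ => gg u v x.1 * gg s t x.2 * ‖FF S a x‖^2) ∩ Set.Ioo u v ×ˢ Set.Ioo s t) :=
    hcont.isOpen_support.inter (isOpen_Ioo.prod isOpen_Ioo)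
  refine lt_of_lt_of_le (hopen.measure_pos volume ⟨x₀, ?_, hx₀⟩)
    (measure_mono (Set.inter_subset_inter_right _ (Set.prod_mono Set.Ioo_subset_Icc_self Set.Ioo_subset_Icc_self)))
  obtain ⟨hx, hy⟩ := hx₀
  have h1 : 0 < gg u v x₀.1 := mul_pos (by linarith [hx.1]) (by linarith [hx.2])
  have h2 : 0 < gg s t x₀.2 := mul_pos (by linarith [hy.1]) (by linarith [hy.2])
  have h3 : 0 < ‖FF S a x₀‖ := norm_pos_iff.2 hne
  exact (by positivity : 0 < gg u v x₀.1 * gg s t x₀.2 * ‖FF S a x₀‖^2).ne'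

lemma lower_fin {u v s t : ℝ} (huv : u < v) (hst : s < t) (S : Finset (ℤ × ℤ)) :
    ∃ C : ℝ, 0 < C ∧ ∀ a : ℤ × ℤ → ℂ, C * ∑ n ∈ S, ‖a n‖^2 ≤
    (∫ x in Set.Icc u v ×ˢ Set.Icc s t, gg u v x.1 * gg s t x.2 * ‖FF S a x‖^2 : ℝ) := by
  set Q : (ℤ × ℤ → ℂ) → ℝ := fun a =>
    (∫ x in Set.Icc u v ×ˢ Set.Icc s t, gg u v x.1 * gg s t x.2 * ‖FF S a x‖^2 : ℝ) with hQ
  have hQe : ∀ a, Q a = (∑ n ∈ S, ∑ m ∈ S, a n * (starRingEnd ℂ) (a m) * cc u v s t (n - m)).re := by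
    intro a
    rw [← expand huv.le hst.le S a, Complex.ofReal_re]
  let ext : EuclideanSpace ℂ S → (ℤ × ℤ → ℂ) := fun b n => if h : n ∈ S then b ⟨n, h⟩ else 0
  have hext : Continuous ext := by
    refine continuous_pi fun n => ?_
    by_cases h : n ∈ S
    · simp only [ext, h, dite_true]; fun_prop
    · simp only [ext, h, dite_false]; fun_prop
  have hc : Continuous fun b => Q (ext b) := by
    have : Continuous Q := by
      rw [show Q = _ from funext hQe]
      fun_prop
    exact this.comp hext
  obtain ⟨C, hC, hmin⟩ := (isCompact_sphere (0 : EuclideanSpace ℂ S) 1).exists_forall_le' hc.continuousOn (a := 0) (by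
    intro b hb
    refine weight_pos huv hst S _ ?_
    have hb0 : b ≠ 0 := by
      rintro rfl
      simp at hb
    by_contra! hcon
    apply hb0
    ext i
    have := hcon i i.2
    simpa [ext] using this)
  refine ⟨C, hC, fun a => ?_⟩
  change _ ≤ Q a
  set A : EuclideanSpace ℂ S := WithLp.toLp 2 fun i => a i with hA
  have hnorm : ∑ n ∈ S, ‖a n‖^2 = ‖A‖^2 := by
    rw [EuclideanSpace.norm_sq_eq, ← Finset.sum_coe_sort]
  have hQA : Q a = Q (ext A) := by
    rw [hQe, hQe]
    congr 1
    refine Finset.sum_congr rfl fun n hn => Finset.sum_congr rfl fun m hm => ?_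
    simp [ext, hn, hm, hA]
  rw [hnorm, hQA]
  by_cases h0 : A = 0
  · rw [h0, norm_zero]
    simp only [hQ]
    have : FF S (ext 0) = 0 := by
      ext x; simp [FF, ext]
    simp [this]
  have hp : 0 < ‖A‖ := norm_pos_iff.2 h0
  have := hmin ((‖A‖⁻¹ : ℂ) • A) (by simp [norm_smul, hp.ne'])
  have hs : Q (ext ((‖A‖⁻¹ : ℂ) • A)) = (‖A‖⁻¹)^2 * Q (ext A) := by
    simp only [hQ]
    rw [← integral_const_mul]
    congr 1
    funext x
    have : FF S (ext ((‖A‖⁻¹ : ℂ) • A)) x = (‖A‖⁻¹ : ℂ) * FF S (ext A) x := by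
      simp only [FF, Finset.mul_sum]
      refine Finset.sum_congr rfl fun n hn => ?_
      simp [ext, hn, mul_assoc]
    rw [this, norm_mul]
    simp only [norm_inv, Complex.norm_real, norm_norm]
    ring
  rw [hs] at this
  calc C * ‖A‖^2 ≤ ((‖A‖⁻¹)^2 * Q (ext A)) * ‖A‖^2 := by gcongr
    _ = Q (ext A) := by field_simp

noncomputable def circS (N : ℕ) : Finset (ℤ × ℤ) :=
  (Finset.Icc (-(N:ℤ)) N ×ˢ Finset.Icc (-(N:ℤ)) N).filter fun n => n.1^2+n.2^2 = (N:ℤ)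

lemma lower_all {u v s t : ℝ} (huv : u < v) (hst : s < t) : ∃ C : ℝ, 0 < C ∧ ∀ N : ℕ, ∀ a : ℤ × ℤ → ℂ,
    C * ∑ n ∈ circS N, ‖a n‖^2 ≤
    (∫ x in Set.Icc u v ×ˢ Set.Icc s t, gg u v x.1 * gg s t x.2 * ‖FF (circS N) a x‖^2 : ℝ) := by
  obtain ⟨C, hC, N₀, h⟩ := lower_large huv hst
  have step : ∀ M : ℕ, ∃ C' : ℝ, 0 < C' ∧ ∀ N < M, ∀ a : ℤ × ℤ → ℂ,
    C' * ∑ n ∈ circS N, ‖a n‖^2 ≤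
    (∫ x in Set.Icc u v ×ˢ Set.Icc s t, gg u v x.1 * gg s t x.2 * ‖FF (circS N) a x‖^2 : ℝ) := by
    intro M
    induction M with
    | zero => exact ⟨1, one_pos, by simp⟩
    | succ M ih =>
      obtain ⟨C₁, h₁, H₁⟩ := ih
      obtain ⟨C₂, h₂, H₂⟩ := lower_fin huv hst (circS M)
      refine ⟨min C₁ C₂, lt_min h₁ h₂, fun N hN a => ?_⟩
      rcases Nat.lt_succ_iff_lt_or_eq.1 hN with hN | rfl
      · exact le_trans (by gcongr; exact min_le_left _ _) (H₁ N hN a)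
      · exact le_trans (by gcongr; exact min_le_right _ _) (H₂ a)
  obtain ⟨C', hC', h'⟩ := step (N₀+1)
  refine ⟨min C C', lt_min hC hC', fun N a => ?_⟩
  rcases lt_or_ge N₀ N with hN | hN
  · exact le_trans (by gcongr; exact min_le_left _ _) (h N hN (circS N) (fun n hn => (Finset.mem_filter.1 hn).2) a)
  · exact le_trans (by gcongr; exact min_le_right _ _) (h' N (by omega) a)

lemma sum_sign (N : ℕ) (f : ℕ → ℂ) (E : ℤ → ℂ) :
    ∑ m ∈ Finset.Icc (-(N:ℤ)) N, (m.sign : ℂ) * f m.natAbs * E m =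
      ∑ j ∈ Finset.range (N+1), f j * (E j - E (-j)) := by
  induction N with
  | zero => simp
  | succ N ih =>
    rw [Finset.sum_range_succ, ← ih]
    have : Finset.Icc (-((N+1:ℕ):ℤ)) ((N+1:ℕ):ℤ) =
        insert ((N+1:ℕ):ℤ) (insert (-((N+1:ℕ):ℤ)) (Finset.Icc (-(N:ℤ)) N)) := by
      ext x; simp only [Finset.mem_Icc, Finset.mem_insert]; push_cast; omega
    have hs : ((N:ℤ)+1).sign = 1 := Int.sign_eq_one_of_pos (by omega)
    have hn : ((N:ℤ)+1).natAbs = N+1 := by omega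
    have hs2 : (-((N:ℤ)+1)).sign = -1 := by rw [Int.sign_neg, hs]
    have hn2 : (-((N:ℤ)+1)).natAbs = N+1 := by omega
    rw [this, Finset.sum_insert, Finset.sum_insert]
    · push_cast
      rw [hs, hs2, hn, hn2]
      push_cast
      ring
    · simp
    · simp only [Finset.mem_insert, Finset.mem_Icc]; push_cast; omega

noncomputable def bb (a : ℕ × ℕ → ℂ) (n : ℤ × ℤ) : ℂ :=
  -(1/4) * (n.1.sign : ℂ) * (n.2.sign : ℂ) * a (n.1.natAbs, n.2.natAbs)

lemma phi_eq (N : ℕ) (a : ℕ × ℕ → ℂ)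
    (ha : ∀ p : ℕ × ℕ, a p ≠ 0 → 0 < p.1 ∧ 0 < p.2 ∧ p.1 ^ 2 + p.2 ^ 2 = N) (x : ℝ × ℝ) :
    ∑ p ∈ Finset.range (N + 1) ×ˢ Finset.range (N + 1),
            a p * Complex.sin (p.1 * x.1) * Complex.sin (p.2 * x.2) = FF (circS N) (bb a) x := by
  have hsin : ∀ (j : ℕ) (y : ℝ), Complex.exp (Complex.I * (((j:ℤ):ℂ) * y)) - Complex.exp (Complex.I * (((-(j:ℤ) : ℤ):ℂ) * y)) =
      2 * Complex.I * Complex.sin (j * y) := by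
    intro j y
    rw [Complex.sin]
    push_cast
    rw [show Complex.I * ((j:ℂ) * y) = j * y * Complex.I by ring, show Complex.I * (-(j:ℂ) * y) = -(j * y) * Complex.I by ring]
    linear_combination (-(Complex.exp (-(↑j * ↑y) * Complex.I) - Complex.exp (↑j * ↑y * Complex.I))) * Complex.I_sq
  have h1 : FF (circS N) (bb a) x = FF (Finset.Icc (-(N:ℤ)) N ×ˢ Finset.Icc (-(N:ℤ)) N) (bb a) x := by
    unfold FF circS
    refine Finset.sum_filter_of_ne fun n _ hn => ?_
    have : a (n.1.natAbs, n.2.natAbs) ≠ 0 := by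
      intro h; apply hn; simp [bb, h]
    have := (ha _ this).2.2
    simp only at this
    rw [← Int.natAbs_sq n.1, ← Int.natAbs_sq n.2]
    exact_mod_cast this
  rw [h1, FF, Finset.sum_product, Finset.sum_product]
  have h2 : ∀ m : ℤ, ∑ k ∈ Finset.Icc (-(N:ℤ)) N, bb a (m, k) * ee (m, k) x =
      (m.sign : ℂ) * (fun i : ℕ => ∑ k ∈ Finset.range (N+1), (-(1/4) * a (i, k)) * (Complex.exp (Complex.I * (((k:ℤ):ℂ) * x.2)) - Complex.exp (Complex.I * (((-(k:ℤ) : ℤ):ℂ) * x.2)))) m.natAbs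
      * Complex.exp (Complex.I * (m * x.1)) := by
    intro m
    simp only
    rw [← sum_sign N (fun k => -(1/4) * a (m.natAbs, k)) (fun k => Complex.exp (Complex.I * (k * x.2)))]
    rw [Finset.mul_sum, Finset.sum_mul]
    refine Finset.sum_congr rfl fun k _ => ?_
    simp only [bb, ee]
    ring
  rw [Finset.sum_congr rfl (fun m _ => h2 m)]
  refine Eq.trans ?_ (sum_sign N (fun i : ℕ => ∑ k ∈ Finset.range (N+1), (-(1/4) * a (i, k)) *
    (Complex.exp (Complex.I * (((k:ℤ):ℂ) * x.2)) - Complex.exp (Complex.I * (((-(k:ℤ) : ℤ):ℂ) * x.2))))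
    (fun m => Complex.exp (Complex.I * (m * x.1)))).symm
  refine Finset.sum_congr rfl fun j _ => ?_
  rw [Finset.sum_mul]
  refine Finset.sum_congr rfl fun k _ => ?_
  rw [hsin, hsin]
  linear_combination (a (j,k) * Complex.sin (j * x.1) * Complex.sin (k * x.2)) * Complex.I_sq

/-- Observability inequality for the eigenfunctions of the Dirichlet Laplacian on the
square `[0,π]²`: for every nonempty open subset `ω` of `(0,π)²` there is a constant
`C_ω > 0` such that every eigenfunction `φ = Σ_{j²+k²=N} a_{jk} sin(jx) sin(ky)`
satisfies `∫_ω |φ|² ≥ C_ω ∫_{[0,π]²} |φ|²`. -/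
theorem dirichlet_square_eigenfunction_observability
    (ω : Set (ℝ × ℝ)) (hω : IsOpen ω) (hωne : ω.Nonempty)
    (hωsub : ω ⊆ Set.Ioo (0 : ℝ) π ×ˢ Set.Ioo (0 : ℝ) π) :
    ∃ C : ℝ, 0 < C ∧
      ∀ N : ℕ, 0 < N → ∀ a : ℕ × ℕ → ℂ,
        (∀ p : ℕ × ℕ, a p ≠ 0 → 0 < p.1 ∧ 0 < p.2 ∧ p.1 ^ 2 + p.2 ^ 2 = N) →
        (∫ x in ω, ‖∑ p ∈ Finset.range (N + 1) ×ˢ Finset.range (N + 1),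
            a p * Complex.sin (p.1 * x.1) * Complex.sin (p.2 * x.2)‖ ^ 2) ≥
          C * ∫ x in Set.Icc (0 : ℝ) π ×ˢ Set.Icc (0 : ℝ) π,
            ‖∑ p ∈ Finset.range (N + 1) ×ˢ Finset.range (N + 1),
              a p * Complex.sin (p.1 * x.1) * Complex.sin (p.2 * x.2)‖ ^ 2 := by
  obtain ⟨z, hz⟩ := hωne
  obtain ⟨ε, hε, hball⟩ := Metric.isOpen_iff.1 hω z hz
  obtain ⟨r, hr, hrsub⟩ : ∃ r : ℝ, 0 < r ∧ Set.Icc (z.1 - r) (z.1 + r) ×ˢ Set.Icc (z.2 - r) (z.2 + r) ⊆ ω := by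
    refine ⟨ε/2, by positivity, fun x hx => hball ?_⟩
    obtain ⟨⟨h1, h2⟩, h3, h4⟩ := hx
    rw [Metric.mem_ball, Prod.dist_eq, Real.dist_eq, Real.dist_eq]
    apply max_lt <;> rw [abs_lt] <;> constructor <;> linarith
  set u := z.1 - r with hu
  set v := z.1 + r with hv
  set s := z.2 - r with hs
  set t := z.2 + r with ht
  have huv : u < v := by linarith
  have hst : s < t := by linarith
  obtain ⟨C₁, hC₁, H₁⟩ := lower_all huv hst
  have hπ := Real.pi_pos
  have hU : (-1:ℝ) ≤ π + 1 := by linarith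
  set K := ∑' n, ‖cc (-1) (π+1) (-1) (π+1) n‖ with hK
  have hK0 : 0 ≤ K := tsum_nonneg fun _ => norm_nonneg _
  refine ⟨C₁ / ((4*r^2)^2 * (K+1)), by positivity, fun N _ a ha => ?_⟩
  simp_rw [phi_eq N a ha]
  set b := bb a
  have hF : Continuous fun x => ‖FF (circS N) b x‖^2 := by fun_prop
  have hint : ∀ p q p' q' : ℝ, IntegrableOn (fun x => ‖FF (circS N) b x‖^2) (Set.Icc p q ×ˢ Set.Icc p' q') :=
    fun p q p' q' => hF.continuousOn.integrableOn_compact (isCompact_Icc.prod isCompact_Icc)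
  have hgint : ∀ p q p' q' : ℝ, IntegrableOn (fun x : ℝ × ℝ => gg p q x.1 * gg p' q' x.2 * ‖FF (circS N) b x‖^2) (Set.Icc p q ×ˢ Set.Icc p' q') :=
    fun p q p' q' => Continuous.continuousOn (by fun_prop) |>.integrableOn_compact (isCompact_Icc.prod isCompact_Icc)
  have hmeas : ∀ p q p' q' : ℝ, MeasurableSet (Set.Icc p q ×ˢ Set.Icc p' q') :=
    fun p q p' q' => measurableSet_Icc.prod measurableSet_Icc
  -- upper bound
  have hup : ∫ x in Set.Icc (0 : ℝ) π ×ˢ Set.Icc (0 : ℝ) π, ‖FF (circS N) b x‖^2 ≤ K * ∑ n ∈ circS N, ‖b n‖^2 := by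
    refine le_trans ?_ (upper hU hU (circS N) b)
    calc _ ≤ ∫ x in Set.Icc (0 : ℝ) π ×ˢ Set.Icc (0 : ℝ) π, gg (-1) (π+1) x.1 * gg (-1) (π+1) x.2 * ‖FF (circS N) b x‖^2 := by
          refine setIntegral_mono_on (hint _ _ _ _) ((hgint _ _ _ _).mono_set
            (Set.prod_mono (Set.Icc_subset_Icc (by linarith) (by linarith)) (Set.Icc_subset_Icc (by linarith) (by linarith)))) (hmeas _ _ _ _) ?_
          rintro x ⟨⟨h1, h2⟩, h3, h4⟩
          have g1 : 1 ≤ gg (-1) (π+1) x.1 := by unfold gg; nlinarith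
          have g2 : 1 ≤ gg (-1) (π+1) x.2 := by unfold gg; nlinarith
          have g3 : 1 ≤ gg (-1) (π+1) x.1 * gg (-1) (π+1) x.2 := by nlinarith
          nlinarith [sq_nonneg ‖FF (circS N) b x‖]
      _ ≤ _ := by
          refine setIntegral_mono_set (hgint _ _ _ _) ?_ (Filter.Eventually.of_forall
            (Set.prod_mono (Set.Icc_subset_Icc (by linarith) (by linarith)) (Set.Icc_subset_Icc (by linarith) (by linarith))))
          filter_upwards [ae_restrict_mem (hmeas _ _ _ _)] with x hx
          obtain ⟨⟨h1, h2⟩, h3, h4⟩ := hx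
          have g1 : 0 ≤ gg (-1) (π+1) x.1 := mul_nonneg (by linarith) (by linarith)
          have g2 : 0 ≤ gg (-1) (π+1) x.2 := mul_nonneg (by linarith) (by linarith)
          simp only [Pi.zero_apply]
          positivity
  -- lower bound
  have hlow : C₁ * ∑ n ∈ circS N, ‖b n‖^2 ≤ (4*r^2)^2 * ∫ x in ω, ‖FF (circS N) b x‖^2 := by
    refine (H₁ N b).trans ?_
    calc _ ≤ ∫ x in Set.Icc u v ×ˢ Set.Icc s t, (4*r^2)^2 * ‖FF (circS N) b x‖^2 := by
          refine setIntegral_mono_on (hgint _ _ _ _) ((hint _ _ _ _).const_mul _) (hmeas _ _ _ _) ?_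
          rintro x ⟨⟨h1, h2⟩, h3, h4⟩
          have g1 : gg u v x.1 ≤ 4*r^2 := by
            calc gg u v x.1 ≤ (2*r)*(2*r) := mul_le_mul (by linarith) (by linarith) (by linarith) (by linarith)
              _ = _ := by ring
          have g2 : gg s t x.2 ≤ 4*r^2 := by
            calc gg s t x.2 ≤ (2*r)*(2*r) := mul_le_mul (by linarith) (by linarith) (by linarith) (by linarith)
              _ = _ := by ring
          have g3 : 0 ≤ gg s t x.2 := mul_nonneg (by linarith) (by linarith)
          rw [sq (4*r^2)]
          gcongr
      _ = (4*r^2)^2 * ∫ x in Set.Icc u v ×ˢ Set.Icc s t, ‖FF (circS N) b x‖^2 := integral_const_mul _ _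
      _ ≤ _ := by
          refine mul_le_mul_of_nonneg_left ?_ (by positivity)
          refine setIntegral_mono_set ((hint 0 π 0 π).mono_set (hωsub.trans (Set.prod_mono Set.Ioo_subset_Icc_self Set.Ioo_subset_Icc_self))) ?_ (Filter.Eventually.of_forall hrsub)
          exact Filter.Eventually.of_forall fun x => by simp only [Pi.zero_apply]; positivity
  have hsum0 : 0 ≤ ∑ n ∈ circS N, ‖b n‖^2 := by positivity
  rw [ge_iff_le, div_mul_eq_mul_div, div_le_iff₀ (by positivity)]
  calc _ ≤ C₁ * (K * ∑ n ∈ circS N, ‖b n‖^2) := by gcongr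
    _ = K * (C₁ * ∑ n ∈ circS N, ‖b n‖^2) := by ring
    _ ≤ (K+1) * (C₁ * ∑ n ∈ circS N, ‖b n‖^2) := by gcongr; linarith
    _ ≤ (K+1) * ((4*r^2)^2 * ∫ x in ω, ‖FF (circS N) b x‖^2) := by gcongr
    _ = _ := by ring
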